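/- arXiv:2110.04136 — 2 statements merged into one kernel-verified Lean document; each statement's English description precedes it below -/
import Mathlib

section
/- For every real constant c ≥ 0, the function F_c(x) = x^{-2}·(log(log(1/x)) + c) is strictly convex on the interval (0, 1/2]; that is, for all x, y ∈ (0, 1/2] with x ≠ y and all t ∈ (0,1), F_c(t·x + (1−t)·y) < t·F_c(x) + (1−t)·F_c(y). -/
/-- The instance-dependent sample-complexity function
`F_c(x) = x⁻² (log log (1/x) + c)`. -/
noncomputable def Fc (c : ℝ) (x : ℝ) : ℝ :=
  (x ^ 2)⁻¹ * (Real.log (Real.log (1 / x)) + c)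

theorem Fc_aux_L {x : ℝ} (hx : x ∈ Set.Ioc (0 : ℝ) (1 / 2)) : 0.69 < Real.log (1 / x) := by
  have h2 : Real.log 2 ≤ Real.log (1 / x) := by
    apply Real.log_le_log (by norm_num)
    rw [le_div_iff₀ hx.1]
    linarith [hx.2]
  have := Real.log_two_gt_d9
  linarith

theorem Fc_aux_log {x : ℝ} (hx : x ≠ 0) :
    HasDerivAt (fun y : ℝ => Real.log (1 / y)) (-x⁻¹) x := by
  have : (fun y : ℝ => Real.log (1 / y)) = fun y => -Real.log y := by
    funext y; simp
  rw [this]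
  exact (Real.hasDerivAt_log hx).neg

theorem Fc_aux_d1 (c : ℝ) {x : ℝ} (hx : x ∈ Set.Ioc (0 : ℝ) (1 / 2)) :
    HasDerivAt (Fc c) (-(x ^ 3)⁻¹ *
      (2 * (Real.log (Real.log (1 / x)) + c) + (Real.log (1 / x))⁻¹)) x := by
  have hL := Fc_aux_L hx
  have hL0 : Real.log (1 / x) ≠ 0 := by intro h; rw [h] at hL; norm_num at hL
  have hx0 : x ≠ 0 := hx.1.ne'
  have h := (((hasDerivAt_pow 2 x).inv (pow_ne_zero 2 hx0)).mul
    (((Fc_aux_log hx0).log hL0).add_const c))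
  refine h.congr_deriv ?_
  simp only [Pi.inv_apply]
  generalize Real.log (1 / x) = L at *
  field_simp
  push_cast
  ring

theorem Fc_aux_d2 (c : ℝ) {x : ℝ} (hx : x ∈ Set.Ioc (0 : ℝ) (1 / 2)) :
    HasDerivAt (fun x : ℝ => -(x ^ 3)⁻¹ *
      (2 * (Real.log (Real.log (1 / x)) + c) + (Real.log (1 / x))⁻¹))
      ((x ^ 4)⁻¹ * (6 * (Real.log (Real.log (1 / x)) + c) + 5 * (Real.log (1 / x))⁻¹
        - (Real.log (1 / x))⁻¹ ^ 2)) x := by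
  have hL := Fc_aux_L hx
  have hL0 : Real.log (1 / x) ≠ 0 := by intro h; rw [h] at hL; norm_num at hL
  have hx0 : x ≠ 0 := hx.1.ne'
  have h := (((hasDerivAt_pow 3 x).inv (pow_ne_zero 3 hx0)).neg.mul
    (((((Fc_aux_log hx0).log hL0).add_const c).const_mul 2).add ((Fc_aux_log hx0).inv hL0)))
  refine h.congr_deriv ?_
  simp only [Pi.inv_apply, Pi.neg_apply, Pi.add_apply]
  generalize Real.log (1 / x) = L at *
  field_simp
  push_cast
  ring

theorem Fc_aux_pos (c : ℝ) (hc : 0 ≤ c) {x : ℝ} (hx : x ∈ Set.Ioc (0 : ℝ) (1 / 2)) :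
    0 < (x ^ 4)⁻¹ * (6 * (Real.log (Real.log (1 / x)) + c) + 5 * (Real.log (1 / x))⁻¹
        - (Real.log (1 / x))⁻¹ ^ 2) := by
  have hL := Fc_aux_L hx
  have hx0 := hx.1
  generalize Real.log (1 / x) = L at *
  have hLp : 0 < L := by linarith
  have h1 := Real.one_sub_inv_le_log_of_pos hLp
  have hu : 0 < L⁻¹ := inv_pos.2 hLp
  have hu2 : L⁻¹ < 1.5 := by
    rw [inv_lt_comm₀ hLp (by norm_num)]
    norm_num at *
    linarith
  apply mul_pos (by positivity)
  nlinarith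

/-- For every `c ≥ 0`, `F_c` is strictly convex on `(0, 1/2]`. -/
theorem Fc_strictConvexOn (c : ℝ) (hc : 0 ≤ c) :
    ∀ x ∈ Set.Ioc (0 : ℝ) (1 / 2), ∀ y ∈ Set.Ioc (0 : ℝ) (1 / 2), x ≠ y →
      ∀ t ∈ Set.Ioo (0 : ℝ) 1,
        Fc c (t * x + (1 - t) * y) < t * Fc c x + (1 - t) * Fc c y := by
  have key : StrictConvexOn ℝ (Set.Ioc (0 : ℝ) (1 / 2)) (Fc c) := by
    apply strictConvexOn_of_deriv2_pos (convex_Ioc _ _)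
    · intro x hx
      exact (Fc_aux_d1 c hx).continuousAt.continuousWithinAt
    · intro x hx
      rw [interior_Ioc] at hx
      have he : deriv (Fc c) =ᶠ[nhds x] (fun x : ℝ => -(x ^ 3)⁻¹ *
          (2 * (Real.log (Real.log (1 / x)) + c) + (Real.log (1 / x))⁻¹)) := by
        filter_upwards [isOpen_Ioo.mem_nhds hx] with y hy
        exact (Fc_aux_d1 c (Set.Ioo_subset_Ioc_self hy)).deriv
      have hx' := Set.Ioo_subset_Ioc_self hx
      have : deriv^[2] (Fc c) x = deriv (deriv (Fc c)) x := rfl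
      rw [this, he.deriv_eq, (Fc_aux_d2 c hx').deriv]
      exact Fc_aux_pos c hc hx'
  intro x hx y hy hxy t ht
  have := key.2 hx hy hxy ht.1 (sub_pos.2 ht.2) (by ring)
  simpa only [smul_eq_mul] using this
end

section
/- Let c ≥ 0 be a real constant and let 0 < a < b ≤ 1/2. Then for every Δ with a ≤ Δ ≤ b, one has F_c(Δ) − F_c(b) ≤ ((F_c(a) − F_c(b))/(b − a)) · (b − Δ), where F_c(x) = x^{-2}·(log(log(1/x)) + c). -/
theorem Fc_convex (c : ℝ) (hc : 0 ≤ c) (a b : ℝ) (ha : 0 < a) (hb : b ≤ 1 / 2) :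
    ConvexOn ℝ (Set.Icc a b) (Fc c) := by
  have key : ∀ x ∈ Set.Icc a b, 0 < x ∧ 1 / 2 < -Real.log x := by
    intro x hx
    have hx0 : 0 < x := lt_of_lt_of_le ha hx.1
    refine ⟨hx0, ?_⟩
    have h1 : Real.log x ≤ Real.log (1 / 2) := Real.log_le_log hx0 (hx.2.trans hb)
    have h2 : Real.log (1 / 2) = -Real.log 2 := by
      rw [one_div, Real.log_inv]
    have := Real.log_two_gt_d9
    linarith
  have hd1 : ∀ x ∈ Set.Icc a b, HasDerivAt (Fc c)
      (-(x ^ 3)⁻¹ * (2 * (Real.log (-Real.log x) + c) + (-Real.log x)⁻¹)) x := by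
    intro x hx
    obtain ⟨hx0, hu⟩ := key x hx
    have hF : Fc c = fun x => (x ^ 2)⁻¹ * (Real.log (-Real.log x) + c) := by
      funext y
      simp [Fc]
    rw [hF]
    have hu0 : -Real.log x ≠ 0 := by linarith
    have hl : Real.log x ≠ 0 := by intro h; apply hu0; simp [h]
    have h := ((hasDerivAt_pow 2 x).fun_inv (by positivity)).fun_mul
      (((Real.hasDerivAt_log hx0.ne').fun_neg.log hu0).add_const c)
    refine h.congr_deriv ?_
    generalize Real.log (-Real.log x) = w
    push_cast
    norm_num
    field_simp
    ring
  have hd2 : ∀ x ∈ Set.Icc a b, HasDerivAt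
      (fun x => -(x ^ 3)⁻¹ * (2 * (Real.log (-Real.log x) + c) + (-Real.log x)⁻¹))
      ((x ^ 4)⁻¹ * (6 * (Real.log (-Real.log x) + c) + 5 * (-Real.log x)⁻¹
        - ((-Real.log x)⁻¹) ^ 2)) x := by
    intro x hx
    obtain ⟨hx0, hu⟩ := key x hx
    have hu0 : -Real.log x ≠ 0 := by linarith
    have hl : Real.log x ≠ 0 := by intro h; apply hu0; simp [h]
    have hn := (Real.hasDerivAt_log hx0.ne').fun_neg
    have h := ((hasDerivAt_pow 3 x).fun_inv (by positivity)).fun_neg.fun_mul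
      ((((hn.log hu0).add_const c).const_mul 2).fun_add (hn.fun_inv hu0))
    refine h.congr_deriv ?_
    generalize Real.log (-Real.log x) = w
    push_cast
    norm_num
    field_simp
    ring
  refine convexOn_of_hasDerivWithinAt2_nonneg (convex_Icc a b)
    (fun x hx => (hd1 x hx).continuousAt.continuousWithinAt)
    (fun x hx => (hd1 x (interior_subset hx)).hasDerivWithinAt)
    (fun x hx => (hd2 x (interior_subset hx)).hasDerivWithinAt) ?_
  intro x hx
  obtain ⟨hx0, hu⟩ := key x (interior_subset hx)
  generalize -Real.log x = u at hu
  have hu0 : 0 < u := by linarith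
  have h1 := Real.one_sub_inv_le_log_of_pos hu0
  have h2 : u⁻¹ < 2 := by
    rw [inv_lt_comm₀ hu0 (by norm_num)]; linarith
  have h3 : 0 < u⁻¹ := inv_pos.2 hu0
  have : 0 ≤ (2 - u⁻¹) * (3 + u⁻¹) := mul_nonneg (by linarith) (by linarith)
  apply mul_nonneg (by positivity)
  nlinarith

/-- Secant-line inequality for `F_c` on `[a, b] ⊆ (0, 1/2]`. -/
theorem Fc_secant (c : ℝ) (hc : 0 ≤ c) (a b : ℝ) (ha : 0 < a) (hab : a < b)
    (hb : b ≤ 1 / 2) (Δ : ℝ) (hΔa : a ≤ Δ) (hΔb : Δ ≤ b) :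
    Fc c Δ - Fc c b ≤ (Fc c a - Fc c b) / (b - a) * (b - Δ) := by
  have hba : 0 < b - a := by linarith
  have h := (Fc_convex c hc a b ha hb).2 (Set.left_mem_Icc.2 hab.le)
    (Set.right_mem_Icc.2 hab.le)
    (div_nonneg (sub_nonneg.2 hΔb) hba.le) (div_nonneg (sub_nonneg.2 hΔa) hba.le)
    (by field_simp; ring)
  simp only [smul_eq_mul] at h
  have e : (b - Δ) / (b - a) * a + (Δ - a) / (b - a) * b = Δ := by
    field_simp; ring
  have e2 : (Δ - a) / (b - a) = 1 - (b - Δ) / (b - a) := by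
    field_simp; ring
  rw [e, e2] at h
  have e3 : (Fc c a - Fc c b) / (b - a) * (b - Δ)
      = (b - Δ) / (b - a) * (Fc c a - Fc c b) := by ring
  rw [e3]
  linarith
end
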